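/- For n ≥ 4, let M_4(n) denote the number of sequences (π_0, π_1, …, π_{n-1}) of permutations in S_4 that are realizable in the (1,4,n)-LRM scheme, i.e., that arise as the sequence of window permutations of some cyclic charge sequence c : Z/nZ → ℤ in which every four cyclically consecutive values c_i, c_{i+1}, c_{i+2}, c_{i+3} are pairwise distinct. Then M_4(n)/4^n tends to 1 as n tends to infinity. -/

import Mathlib

/-- A cyclic charge sequence `c : ZMod n → ℤ` has pairwise distinct values in every
window of four cyclically consecutive cells. -/
def DistinctWindows4 (n : ℕ) (c : ZMod n → ℤ) : Prop :=
  ∀ i : ZMod n, ∀ k l : Fin 4, k ≠ l →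
    c (i + ((k : ℕ) : ZMod n)) ≠ c (i + ((l : ℕ) : ZMod n))

/-- A sequence of permutations `π : ZMod n → S_4` is realizable in the `(1,4,n)`-LRM
scheme: there is a cyclic charge sequence `c` with pairwise distinct values in each
window of four cyclically consecutive cells such that `π i` lists the four positions
of the `i`-th window in order from the highest charge to the lowest, i.e. the cell at
(relative) position `π i k` in the window has higher charge than the one at position
`π i l` whenever `k < l`. -/
def Realizable4 (n : ℕ) (π : ZMod n → Equiv.Perm (Fin 4)) : Prop :=
  ∃ c : ZMod n → ℤ, DistinctWindows4 n c ∧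
    ∀ i : ZMod n, ∀ k l : Fin 4, k < l →
      c (i + ((π i k : ℕ) : ZMod n)) > c (i + ((π i l : ℕ) : ZMod n))

/-- `M₄ n` is the number of realizable sequences of permutations of `S_4`
in the `(1,4,n)`-LRM scheme. -/
noncomputable def M₄ (n : ℕ) : ℕ :=
  Nat.card {π : ZMod n → Equiv.Perm (Fin 4) // Realizable4 n π}

open Finset in
theorem aux_symm_eq_card {α : Type*} [LinearOrder α] (g : Fin 4 → α) (σ : Equiv.Perm (Fin 4))
    (h : ∀ k l : Fin 4, k < l → g (σ k) > g (σ l)) (k : Fin 4) :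
    ((σ.symm k : Fin 4) : ℕ) = #{l : Fin 4 | g k < g l} := by
  have hanti : StrictAnti (fun i => g (σ i)) := fun a b hab => h a b hab
  have : (univ.filter fun l : Fin 4 => g k < g l) = (Finset.Iio (σ.symm k)).map σ.toEmbedding := by
    ext l
    simp only [mem_filter, mem_univ, true_and, mem_map_equiv, mem_Iio]
    have := hanti.lt_iff_gt (a := σ.symm k) (b := σ.symm l)
    simpa using this
  rw [this, card_map, Fin.card_Iio]

/-- rank of the last -/
def rk {α : Type*} [LinearOrder α] (u v w y : α) : ℕ :=
  (if y < u then 1 else 0) + (if y < v then 1 else 0) + (if y < w then 1 else 0)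

def code {n : ℕ} (π : ZMod n → Equiv.Perm (Fin 4)) : ZMod n → Fin 4 := fun i => (π i).symm 3

def Wit {n : ℕ} (π : ZMod n → Equiv.Perm (Fin 4)) (c : ZMod n → ℤ) : Prop :=
  DistinctWindows4 n c ∧
    ∀ i : ZMod n, ∀ k l : Fin 4, k < l →
      c (i + ((π i k : ℕ) : ZMod n)) > c (i + ((π i l : ℕ) : ZMod n))

theorem Wit.code_eq {n : ℕ} {π : ZMod n → Equiv.Perm (Fin 4)} {c : ZMod n → ℤ} (h : Wit π c)
    (i : ZMod n) : (code π i : ℕ) = rk (c i) (c (i+1)) (c (i+2)) (c (i+3)) := by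
  have := aux_symm_eq_card (fun k : Fin 4 => c (i + ((k : ℕ) : ZMod n))) (π i) (h.2 i) 3
  rw [code, this, Finset.card_filter, Fin.sum_univ_four]
  simp [rk]

def SameState {n : ℕ} (c c' : ZMod n → ℤ) (i : ZMod n) : Prop :=
  (c i < c (i+1) ↔ c' i < c' (i+1)) ∧ (c i < c (i+2) ↔ c' i < c' (i+2)) ∧
  (c (i+1) < c (i+2) ↔ c' (i+1) < c' (i+2))

theorem dist6 {n : ℕ} {c : ZMod n → ℤ} (h : DistinctWindows4 n c) (i : ZMod n) :
    c i ≠ c (i+1) ∧ c i ≠ c (i+2) ∧ c i ≠ c (i+3) ∧ c (i+1) ≠ c (i+2) ∧ c (i+1) ≠ c (i+3) ∧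
    c (i+2) ≠ c (i+3) := by
  have h1 := h i 0 1 (by decide)
  have h2 := h i 0 2 (by decide)
  have h3 := h i 0 3 (by decide)
  have h4 := h i 1 2 (by decide)
  have h5 := h i 1 3 (by decide)
  have h6 := h i 2 3 (by decide)
  simp at h1 h2 h3 h4 h5 h6
  exact ⟨h1, h2, h3, h4, h5, h6⟩

theorem rk_step (u v w y u' v' w' y' : ℤ)
    (d : u ≠ v ∧ u ≠ w ∧ u ≠ y ∧ v ≠ w ∧ v ≠ y ∧ w ≠ y)
    (d' : u' ≠ v' ∧ u' ≠ w' ∧ u' ≠ y' ∧ v' ≠ w' ∧ v' ≠ y' ∧ w' ≠ y')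
    (s1 : u < v ↔ u' < v') (s2 : u < w ↔ u' < w') (s3 : v < w ↔ v' < w')
    (hr : rk u v w y = rk u' v' w' y') :
    (u < y ↔ u' < y') ∧ (v < y ↔ v' < y') ∧ (w < y ↔ w' < y') := by
  unfold rk at hr
  obtain ⟨a1, a2, a3, a4, a5, a6⟩ := d
  obtain ⟨b1, b2, b3, b4, b5, b6⟩ := d'
  by_cases p1 : u < v <;> by_cases p2 : u < w <;> by_cases p3 : v < w <;>
    simp only [p1, p2, p3, true_iff, false_iff] at s1 s2 s3 <;>
    split_ifs at hr <;> omega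

theorem flip_iff {a b a' b' : ℤ} (h : a ≠ b) (h' : a' ≠ b') (s : a < b ↔ a' < b') :
    b < a ↔ b' < a' := by omega

theorem state_step {n : ℕ} {π π' : ZMod n → Equiv.Perm (Fin 4)} {c c' : ZMod n → ℤ}
    (h : Wit π c) (h' : Wit π' c') (hc : code π = code π') (i : ZMod n)
    (s : SameState c c' i) :
    SameState c c' (i+1) ∧ π i = π' i := by
  have e := h.code_eq i
  rw [hc, h'.code_eq i] at e
  have d := dist6 h.1 i
  have d' := dist6 h'.1 i
  obtain ⟨s1, s2, s3⟩ := s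
  obtain ⟨t1, t2, t3⟩ := rk_step _ _ _ _ _ _ _ _ d d' s1 s2 s3 e.symm
  constructor
  · unfold SameState
    rw [add_assoc, add_assoc, one_add_one_eq_two, show (1:ZMod n) + 2 = 3 by norm_num]
    exact ⟨s3, t2, t3⟩
  · have key : ∀ k l : Fin 4, (c (i + ((k : ℕ) : ZMod n)) < c (i + ((l : ℕ) : ZMod n)) ↔
        c' (i + ((k : ℕ) : ZMod n)) < c' (i + ((l : ℕ) : ZMod n))) := by
      obtain ⟨a1, a2, a3, a4, a5, a6⟩ := d
      obtain ⟨b1, b2, b3, b4, b5, b6⟩ := d'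
      intro k l
      have f1 := flip_iff a1 b1 s1
      have f2 := flip_iff a2 b2 s2
      have f3 := flip_iff a3 b3 t1
      have f4 := flip_iff a4 b4 s3
      have f5 := flip_iff a5 b5 t2
      have f6 := flip_iff a6 b6 t3
      clear e hc h h' a1 a2 a3 a4 a5 a6 b1 b2 b3 b4 b5 b6
      fin_cases k <;> fin_cases l <;>
        simp only [Nat.cast_zero, Nat.cast_one, Nat.cast_ofNat, add_zero, lt_irrefl] <;>
        assumption
    have : (π i).symm = (π' i).symm := by
      ext k
      rw [aux_symm_eq_card (fun k : Fin 4 => c (i + ((k : ℕ) : ZMod n))) _ (h.2 i) k,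
        aux_symm_eq_card (fun k : Fin 4 => c' (i + ((k : ℕ) : ZMod n))) _ (h'.2 i) k]
      simp only [key]
    simpa using congrArg Equiv.symm this

theorem eq_of_state {n : ℕ} [NeZero n] {π π' : ZMod n → Equiv.Perm (Fin 4)} {c c' : ZMod n → ℤ}
    (h : Wit π c) (h' : Wit π' c') (hc : code π = code π') (i : ZMod n)
    (s : SameState c c' i) : π = π' := by
  have key : ∀ k : ℕ, SameState c c' (i + (k : ZMod n)) := by
    intro k
    induction k with
    | zero => simpa using s
    | succ k ih =>
      have := (state_step h h' hc _ ih).1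
      rwa [add_assoc, ← Nat.cast_succ] at this
  funext j
  have := (state_step h h' hc _ (key (j - i).val)).2
  rwa [ZMod.natCast_zmod_val, add_sub_cancel] at this

theorem state_of_perm {n : ℕ} {π π' : ZMod n → Equiv.Perm (Fin 4)} {c c' : ZMod n → ℤ}
    (h : Wit π c) (h' : Wit π' c') (i : ZMod n) (hi : π i = π' i) : SameState c c' i := by
  have key : ∀ k l : Fin 4, (c (i + ((k : ℕ) : ZMod n)) < c (i + ((l : ℕ) : ZMod n)) ↔
        c' (i + ((k : ℕ) : ZMod n)) < c' (i + ((l : ℕ) : ZMod n))) := by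
    intro k l
    have A1 : StrictAnti (fun k : Fin 4 => c (i + ((π i k : ℕ) : ZMod n))) :=
      fun a b hab => h.2 i a b hab
    have A2 : StrictAnti (fun k : Fin 4 => c' (i + ((π' i k : ℕ) : ZMod n))) :=
      fun a b hab => h'.2 i a b hab
    have B1 := A1.lt_iff_gt (a := (π i).symm k) (b := (π i).symm l)
    have B2 := A2.lt_iff_gt (a := (π i).symm k) (b := (π i).symm l)
    rw [← hi] at B2
    simp only [Equiv.apply_symm_apply] at B1 B2
    rw [B1, B2]
  have k1 := key 0 1
  have k2 := key 0 2
  have k3 := key 1 2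
  simp at k1 k2 k3
  exact ⟨k1, k2, k3⟩

theorem state_of_const {n : ℕ} {π : ZMod n → Equiv.Perm (Fin 4)} {c : ZMod n → ℤ}
    (h : Wit π c) (b : ZMod n) (h0 : code π b = 0) (h1 : code π (b+1) = 0)
    (h2 : code π (b+2) = 0) :
    c (b+3) < c (b+3+1) ∧ c (b+3) < c (b+3+2) ∧ c (b+3+1) < c (b+3+2) := by
  have e1 := h.code_eq (b+1)
  have e2 := h.code_eq (b+2)
  have d1 := dist6 h.1 (b+1)
  have d2 := dist6 h.1 (b+2)
  rw [h1] at e1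
  rw [h2] at e2
  simp only [add_assoc] at *
  norm_num [rk] at e1 e2 d1 d2 ⊢
  split_ifs at e1 e2 <;> omega

theorem insert_exists (m : Fin 4) (u v w : ℚ) (h1 : u ≠ v) (h2 : u ≠ w) (h3 : v ≠ w) :
    ∃ y : ℚ, y ≠ u ∧ y ≠ v ∧ y ≠ w ∧ rk u v w y = m ∧ (m = 3 → y < 0) ∧
      (u < 0 → v < 0 → w < 0 → y < 0) := by
  have main : ∀ u v w : ℚ, u < v → v < w → ∃ y : ℚ, y ≠ u ∧ y ≠ v ∧ y ≠ w ∧ rk u v w y = m ∧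
      (m = 3 → y < 0) ∧ (u < 0 → v < 0 → w < 0 → y < 0) := by
    intro u v w huv hvw
    fin_cases m
    · by_cases hw : w < 0
      · refine ⟨w / 2, ?_, ?_, ?_, ?_, by simp, fun _ _ _ => by linarith⟩
        · intro h; linarith
        · intro h; linarith
        · intro h; linarith
        · simp only [rk]
          rw [if_neg (by linarith), if_neg (by linarith), if_neg (by linarith)]
      · refine ⟨w + 1, ?_, ?_, ?_, ?_, by simp, fun _ _ h => absurd h hw⟩
        · intro h; linarith
        · intro h; linarith
        · intro h; linarith
        · simp only [rk]
          rw [if_neg (by linarith), if_neg (by linarith), if_neg (by linarith)]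
    · refine ⟨(v + w) / 2, ?_, ?_, ?_, ?_, by simp, fun _ _ _ => by linarith⟩
      · intro h; linarith
      · intro h; linarith
      · intro h; linarith
      · simp only [rk]
        rw [if_neg (by linarith), if_neg (by linarith), if_pos (by linarith)]
    · refine ⟨(u + v) / 2, ?_, ?_, ?_, ?_, by simp, fun _ _ _ => by linarith⟩
      · intro h; linarith
      · intro h; linarith
      · intro h; linarith
      · simp only [rk]
        rw [if_neg (by linarith), if_pos (by linarith), if_pos (by linarith)]
    · have := min_le_left u 0
      have := min_le_right u 0
      refine ⟨min u 0 - 1, ?_, ?_, ?_, ?_, fun _ => by linarith, fun _ _ _ => by linarith⟩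
      · intro h; linarith
      · intro h; linarith
      · intro h; linarith
      · simp only [rk]
        rw [if_pos (by linarith), if_pos (by linarith), if_pos (by linarith)]
  unfold rk at *
  rcases lt_or_gt_of_ne h1 with a | a <;> rcases lt_or_gt_of_ne h2 with b | b <;>
    rcases lt_or_gt_of_ne h3 with c | c
  · obtain ⟨y, z⟩ := main u v w a c; exact ⟨y, by grind⟩
  · obtain ⟨y, z⟩ := main u w v b c; exact ⟨y, by grind⟩
  · linarith
  · obtain ⟨y, z⟩ := main w u v b a; exact ⟨y, by grind⟩
  · obtain ⟨y, z⟩ := main v u w a b; exact ⟨y, by grind⟩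
  · linarith
  · obtain ⟨y, z⟩ := main v w u c b; exact ⟨y, by grind⟩
  · obtain ⟨y, z⟩ := main w v u c a; exact ⟨y, by grind⟩

theorem seq_exists (e : ℕ → Fin 4) : ∃ x : ℕ → ℚ, x 0 = 0 ∧ x 1 = 1 ∧ x 2 = 2 ∧
    ∀ k, (x k ≠ x (k+1) ∧ x k ≠ x (k+2) ∧ x (k+1) ≠ x (k+2)) ∧
      (x (k+3) ≠ x k ∧ x (k+3) ≠ x (k+1) ∧ x (k+3) ≠ x (k+2)) ∧
      rk (x k) (x (k+1)) (x (k+2)) (x (k+3)) = e k ∧ (e k = 3 → x (k+3) < 0) ∧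
      (x k < 0 → x (k+1) < 0 → x (k+2) < 0 → x (k+3) < 0) := by
  have H : ∀ (m : Fin 4) (u v w : ℚ), ∃ y : ℚ, (u ≠ v ∧ u ≠ w ∧ v ≠ w) →
      (y ≠ u ∧ y ≠ v ∧ y ≠ w ∧ rk u v w y = m ∧ (m = 3 → y < 0) ∧
      (u < 0 → v < 0 → w < 0 → y < 0)) := by
    intro m u v w
    by_cases h : u ≠ v ∧ u ≠ w ∧ v ≠ w
    · obtain ⟨y, hy⟩ := insert_exists m u v w h.1 h.2.1 h.2.2
      exact ⟨y, fun _ => hy⟩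
    · exact ⟨0, fun h' => absurd h' h⟩
  choose f hf using H
  let t : ℕ → ℚ × ℚ × ℚ := fun k => Nat.rec (0, 1, 2)
    (fun k p => (p.2.1, p.2.2, f (e k) p.1 p.2.1 p.2.2)) k
  have t1 : ∀ k, (t (k+1)).1 = (t k).2.1 := fun k => rfl
  have t2 : ∀ k, (t (k+1)).2.1 = (t k).2.2 := fun k => rfl
  have t3 : ∀ k, (t (k+1)).2.2 = f (e k) (t k).1 (t k).2.1 (t k).2.2 := fun k => rfl
  let x : ℕ → ℚ := fun k => (t k).1
  have x1 : ∀ k, x (k+1) = (t k).2.1 := fun k => rfl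
  have x2 : ∀ k, x (k+2) = (t k).2.2 := fun k => rfl
  have x3 : ∀ k, x (k+3) = f (e k) (x k) (x (k+1)) (x (k+2)) := fun k => rfl
  have hd : ∀ k, x k ≠ x (k+1) ∧ x k ≠ x (k+2) ∧ x (k+1) ≠ x (k+2) := by
    intro k
    induction k with
    | zero =>
      have a0 : x 0 = 0 := rfl
      have a1 : x 1 = 1 := rfl
      have a2 : x 2 = 2 := rfl
      simp only [zero_add, a0, a1, a2]; norm_num
    | succ k ih =>
      have := hf (e k) _ _ _ ih
      rw [← x3] at this
      exact ⟨ih.2.2, this.2.1.symm, this.2.2.1.symm⟩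
  refine ⟨x, rfl, rfl, rfl, fun k => ⟨hd k, ?_⟩⟩
  have := hf (e k) _ _ _ (hd k)
  rw [← x3] at this
  exact ⟨⟨this.1, this.2.1, this.2.2.1⟩, this.2.2.2⟩

theorem neg_tail (e : ℕ → Fin 4) (x : ℕ → ℚ)
    (hx : ∀ k, (x k ≠ x (k+1) ∧ x k ≠ x (k+2) ∧ x (k+1) ≠ x (k+2)) ∧
      (x (k+3) ≠ x k ∧ x (k+3) ≠ x (k+1) ∧ x (k+3) ≠ x (k+2)) ∧
      rk (x k) (x (k+1)) (x (k+2)) (x (k+3)) = e k ∧ (e k = 3 → x (k+3) < 0) ∧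
      (x k < 0 → x (k+1) < 0 → x (k+2) < 0 → x (k+3) < 0))
    (a : ℕ) (h0 : e a = 3) (h1 : e (a+1) = 3) (h2 : e (a+2) = 3) :
    ∀ k, x (a+3+k) < 0 ∧ x (a+3+k+1) < 0 ∧ x (a+3+k+2) < 0 := by
  intro k
  induction k with
  | zero => exact ⟨(hx a).2.2.2.1 h0, (hx (a+1)).2.2.2.1 h1, (hx (a+2)).2.2.2.1 h2⟩
  | succ k ih => exact ⟨ih.2.1, ih.2.2, (hx (a+3+k)).2.2.2.2 ih.1 ih.2.1 ih.2.2⟩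

theorem exists_rat {n : ℕ} [NeZero n] (e : ZMod n → Fin 4) (a b : ZMod n)
    (ha0 : e a = 3) (ha1 : e (a+1) = 3) (ha2 : e (a+2) = 3)
    (hb0 : e b = 0) (hb1 : e (b+1) = 0) (hb2 : e (b+2) = 0) :
    ∃ c : ZMod n → ℚ, ∀ i, rk (c i) (c (i+1)) (c (i+2)) (c (i+3)) = e i ∧
      c (i+3) ≠ c i ∧ c (i+3) ≠ c (i+1) ∧ c (i+3) ≠ c (i+2) := by
  obtain ⟨x, x0, x1, x2, hx⟩ := seq_exists (fun k => e (b + 3 + (k : ZMod n)))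
  have hn0 : (n : ZMod n) = 0 := ZMod.natCast_self n
  set p := (a - (b + 3)).val with hp
  have hpn : p < n := ZMod.val_lt _
  have hpa : b + 3 + (p : ZMod n) = a := by rw [hp, ZMod.natCast_zmod_val]; ring
  have hne : (3 : Fin 4) ≠ 0 := by decide
  -- positions
  have q0 : ∀ q : ℕ, q + 3 = n → e (b + 3 + (q : ZMod n)) = 0 := by
    intro q hq
    have : ((q + 3 : ℕ) : ZMod n) = 0 := by rw [hq, hn0]
    push_cast at this
    rw [show b + 3 + (q : ZMod n) = b + (q + 3) by ring, this, add_zero, hb0]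
  have q1 : ∀ q : ℕ, q + 2 = n → e (b + 3 + (q : ZMod n)) = 0 := by
    intro q hq
    have : ((q + 2 : ℕ) : ZMod n) = 0 := by rw [hq, hn0]
    push_cast at this
    rw [show b + 3 + (q : ZMod n) = b + 1 + (q + 2) by ring, this, add_zero, hb1]
  have q2 : ∀ q : ℕ, q + 1 = n → e (b + 3 + (q : ZMod n)) = 0 := by
    intro q hq
    have : ((q + 1 : ℕ) : ZMod n) = 0 := by rw [hq, hn0]
    push_cast at this
    rw [show b + 3 + (q : ZMod n) = b + 2 + (q + 1) by ring, this, add_zero, hb2]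
  have e0 : e (b + 3 + (p : ZMod n)) = 3 := by rw [hpa, ha0]
  have e1 : e (b + 3 + ((p + 1 : ℕ) : ZMod n)) = 3 := by
    push_cast; rw [← add_assoc, hpa, ha1]
  have e2 : e (b + 3 + ((p + 2 : ℕ) : ZMod n)) = 3 := by
    push_cast; rw [← add_assoc, hpa, ha2]
  have hp6 : p + 6 ≤ n := by
    by_contra hcon
    have : p + 1 = n ∨ p + 2 = n ∨ p + 3 = n ∨ p + 2 + 2 = n ∨ p + 2 + 3 = n := by omega
    rcases this with h | h | h | h | h
    · exact hne (e0.symm.trans (q2 _ h))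
    · exact hne (e0.symm.trans (q1 _ h))
    · exact hne (e0.symm.trans (q0 _ h))
    · exact hne (e2.symm.trans (q1 _ h))
    · exact hne (e2.symm.trans (q0 _ h))
  have htail := neg_tail _ x hx p e0 e1 e2 (n - (p + 6))
  obtain ⟨N, rfl⟩ : ∃ N, n = N + 3 := ⟨n - 3, by omega⟩
  rw [show p + 3 + (N + 3 - (p + 6)) = N by omega] at htail
  obtain ⟨n0, n1, n2⟩ := htail
  let c : ZMod (N+3) → ℚ := fun j => x (j - (b + 3)).val
  have hc : ∀ k : ℕ, k < N + 3 → c (b + 3 + (k : ZMod (N+3))) = x k := by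
    intro k hk
    simp only [c]
    rw [add_sub_cancel_left, ZMod.val_natCast_of_lt hk]
  have hc' : ∀ (k m r : ℕ), r < N + 3 → (k + m = r ∨ k + m = r + (N + 3)) →
      c (b + 3 + (k : ZMod (N+3)) + (m : ZMod (N+3))) = x r := by
    intro k m r hr h
    rw [add_assoc, ← Nat.cast_add]
    rcases h with h | h
    · rw [h, hc _ hr]
    · rw [h, Nat.cast_add, hn0, add_zero, hc _ hr]
  have main : ∀ k : ℕ, k < N + 3 → ∀ i, i = b + 3 + (k : ZMod (N+3)) → 
      rk (c i) (c (i+1)) (c (i+2)) (c (i+3)) = e i ∧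
      c (i+3) ≠ c i ∧ c (i+3) ≠ c (i+1) ∧ c (i+3) ≠ c (i+2) := by
    intro k hk i hi
    have g : ∀ r0 r1 r2 r3 : ℕ, r0 < N+3 → r1 < N+3 → r2 < N+3 → r3 < N+3 →
        k = r0 → (k + 1 = r1 ∨ k + 1 = r1 + (N+3)) → (k + 2 = r2 ∨ k + 2 = r2 + (N+3)) →
        (k + 3 = r3 ∨ k + 3 = r3 + (N+3)) → c i = x r0 ∧ c (i+1) = x r1 ∧ c (i+2) = x r2 ∧
          c (i+3) = x r3 := by
      intro r0 r1 r2 r3 l0 l1 l2 l3 h0 h1 h2 h3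
      subst hi
      have z0 := hc k hk
      have z1 := hc' k 1 r1 l1 h1
      have z2 := hc' k 2 r2 l2 h2
      have z3 := hc' k 3 r3 l3 h3
      push_cast at z1 z2 z3
      exact ⟨h0 ▸ z0, z1, z2, z3⟩
    by_cases h3 : k + 3 < N + 3
    · obtain ⟨y0, y1, y2, y3⟩ := g k (k+1) (k+2) (k+3) (by omega) (by omega) (by omega) (by omega)
        (by omega) (by omega) (by omega) (by omega)
      rw [y0, y1, y2, y3, hi]
      exact ⟨(hx k).2.2.1, (hx k).2.1⟩
    · have : k = N ∨ k = N + 1 ∨ k = N + 2 := by omega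
      rcases this with h | h | h
      · obtain ⟨y0, y1, y2, y3⟩ := g N (N+1) (N+2) 0 (by omega) (by omega) (by omega) (by omega)
          (by omega) (by omega) (by omega) (by omega)
        rw [y0, y1, y2, y3, hi, q0 k (by omega), x0]
        refine ⟨?_, n0.ne', n1.ne', n2.ne'⟩
        simp [rk, n0.le, n1.le, n2.le]
      · obtain ⟨y0, y1, y2, y3⟩ := g (N+1) (N+2) 0 1 (by omega) (by omega) (by omega) (by omega)
          (by omega) (by omega) (by omega) (by omega)
        rw [y0, y1, y2, y3, hi, q1 k (by omega), x0, x1]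
        refine ⟨?_, by linarith, by linarith, by norm_num⟩
        simp only [rk]
        rw [if_neg (by linarith), if_neg (by linarith), if_neg (by linarith)]; rfl
      · obtain ⟨y0, y1, y2, y3⟩ := g (N+2) 0 1 2 (by omega) (by omega) (by omega) (by omega)
          (by omega) (by omega) (by omega) (by omega)
        rw [y0, y1, y2, y3, hi, q2 k (by omega), x0, x1, x2]
        refine ⟨?_, by linarith, by norm_num, by norm_num⟩
        simp only [rk]
        rw [if_neg (by linarith), if_neg (by linarith), if_neg (by linarith)]; rfl
  refine ⟨c, fun i => main (i - (b+3)).val (ZMod.val_lt _) i ?_⟩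
  rw [ZMod.natCast_zmod_val]; ring

open Finset in
theorem exists_int {ι : Type*} [Fintype ι] (c : ι → ℚ) :
    ∃ c' : ι → ℤ, ∀ i j, c' i < c' j ↔ c i < c j := by
  refine ⟨fun i => (#{k : ι | c k < c i} : ℤ), fun i j => ?_⟩
  have mono : ∀ i j, c i ≤ c j → #{k : ι | c k < c i} ≤ #{k : ι | c k < c j} := by
    intro i j h
    apply card_le_card
    intro k
    simp only [mem_filter, mem_univ, true_and]
    exact fun hk => hk.trans_le h
  constructor
  · intro h
    by_contra hcon
    have := mono j i (not_lt.mp hcon)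
    simp only at h
    omega
  · intro h
    simp only [Nat.cast_lt]
    apply card_lt_card
    rw [ssubset_iff_of_subset]
    · exact ⟨i, by simpa using h, by simp⟩
    · intro k
      simp only [mem_filter, mem_univ, true_and]
      exact fun hk => hk.trans h

theorem exists_real {n : ℕ} [NeZero n] (e : ZMod n → Fin 4) (a b : ZMod n)
    (ha0 : e a = 3) (ha1 : e (a+1) = 3) (ha2 : e (a+2) = 3)
    (hb0 : e b = 0) (hb1 : e (b+1) = 0) (hb2 : e (b+2) = 0) :
    ∃ π, Realizable4 n π ∧ code π = e := by
  obtain ⟨c0, h0⟩ := exists_rat e a b ha0 ha1 ha2 hb0 hb1 hb2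
  obtain ⟨c, hc⟩ := exists_int c0
  have h : ∀ i, rk (c i) (c (i+1)) (c (i+2)) (c (i+3)) = e i ∧
      c (i+3) ≠ c i ∧ c (i+3) ≠ c (i+1) ∧ c (i+3) ≠ c (i+2) := by
    have hne : ∀ i j, c i ≠ c j ↔ c0 i ≠ c0 j := by
      intro i j
      rw [ne_iff_lt_or_gt, ne_iff_lt_or_gt, hc, hc]
    intro i
    have := h0 i
    simp only [rk, hne, hc] at this ⊢
    exact this
  have hd : DistinctWindows4 n c := by
    intro i k l hkl
    have w0 := (h i).2
    have w1 := (h (i-1)).2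
    have w2 := (h (i-2)).2
    rw [show i - 1 + 3 = i + 2 by ring, show i - 1 + 2 = i + 1 by ring, sub_add_cancel] at w1
    rw [show i - 2 + 3 = i + 1 by ring, sub_add_cancel] at w2
    obtain ⟨a1, a2, a3⟩ := w0
    obtain ⟨b1, b2, b3⟩ := w1
    obtain ⟨d1, d2, d3⟩ := w2
    fin_cases k <;> fin_cases l <;> simp at hkl ⊢ <;> omega
  have hp : ∀ i : ZMod n, ∃ σ : Equiv.Perm (Fin 4), ∀ k l : Fin 4, k < l →
      c (i + ((σ k : ℕ) : ZMod n)) > c (i + ((σ l : ℕ) : ZMod n)) := by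
    intro i
    let g : Fin 4 → ℤ := fun k => - c (i + ((k : ℕ) : ZMod n))
    have hg : Function.Injective g := by
      intro k l hkl
      by_contra hcon
      exact hd i k l hcon (neg_injective hkl)
    have hs : StrictMono (g ∘ Tuple.sort g) :=
      (Tuple.monotone_sort g).strictMono_of_injective (hg.comp (Tuple.sort g).injective)
    refine ⟨Tuple.sort g, fun k l hkl => ?_⟩
    have := hs hkl
    simpa [g] using this
  choose π hπ using hp
  have hw : Wit π c := ⟨hd, hπ⟩
  refine ⟨π, ⟨c, hw⟩, ?_⟩
  funext i
  apply Fin.ext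
  rw [hw.code_eq, (h i).1]

def Has {n : ℕ} (v : Fin 4) (e : ZMod n → Fin 4) : Prop :=
  ∃ i, e i = v ∧ e (i+1) = v ∧ e (i+2) = v

theorem bad_card (n : ℕ) [NeZero n] (v : Fin 4) :
    Nat.card {e : ZMod n → Fin 4 // ¬ Has v e} ≤ 63 ^ (n/3) * 4 ^ (n%3) := by
  let T := {t : Fin 3 → Fin 4 // t ≠ fun _ => v}
  let F : {e : ZMod n → Fin 4 // ¬ Has v e} → (Fin (n/3) → T) × (Fin (n%3) → Fin 4) :=
    fun e => (fun j => ⟨fun k => e.1 ((3 * (j : ℕ) + (k : ℕ) : ℕ) : ZMod n), fun h => by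
      apply e.2
      have h0 := congrFun h 0
      have h1 := congrFun h 1
      have h2 := congrFun h 2
      refine ⟨((3 * (j : ℕ) : ℕ) : ZMod n), ?_, ?_, ?_⟩
      · simpa using h0
      · simpa using h1
      · simpa using h2⟩,
      fun r => e.1 ((3 * (n/3) + (r : ℕ) : ℕ) : ZMod n))
  have hF : Function.Injective F := by
    intro e e' h
    apply Subtype.ext
    funext i
    have hi := ZMod.val_lt i
    rw [← ZMod.natCast_zmod_val i]
    generalize i.val = q at hi
    by_cases hq : q / 3 < n / 3
    · have := congrFun (congrArg Subtype.val (congrFun (congrArg Prod.fst h) ⟨q/3, hq⟩))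
        ⟨q % 3, Nat.mod_lt _ (by norm_num)⟩
      simpa only [F, Nat.div_add_mod] using this
    · have := congrFun (congrArg Prod.snd h) ⟨q - 3 * (n/3), by omega⟩
      simp only [F] at this
      rwa [show 3 * (n/3) + (q - 3 * (n/3)) = q by omega] at this
  have hT : Nat.card T = 63 := by
    rw [Nat.card_eq_fintype_card, Fintype.card_subtype_compl]
    simp
  have := Nat.card_le_card_of_injective F hF
  rw [Nat.card_prod, Nat.card_fun, Nat.card_fun, hT] at this
  simpa using this

theorem bounds (n : ℕ) [NeZero n] :
    4 ^ n ≤ M₄ n + 2 * (63 ^ (n/3) * 4 ^ (n%3)) ∧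
    M₄ n ≤ 4 ^ n + 24 * (2 * (63 ^ (n/3) * 4 ^ (n%3))) := by
  classical
  let G : Type := {e : ZMod n → Fin 4 // Has 0 e ∧ Has 3 e}
  let B : Type := {e : ZMod n → Fin 4 // ¬ (Has 0 e ∧ Has 3 e)}
  let R : Type := {π : ZMod n → Equiv.Perm (Fin 4) // Realizable4 n π}
  have hB : Nat.card B ≤ 2 * (63 ^ (n/3) * 4 ^ (n%3)) := by
    have h0 := bad_card n 0
    have h3 := bad_card n 3
    let f : B → {e : ZMod n → Fin 4 // ¬ Has 0 e} ⊕ {e : ZMod n → Fin 4 // ¬ Has 3 e} :=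
      fun e => if h : Has 0 e.1 then Sum.inr ⟨e.1, fun h' => e.2 ⟨h, h'⟩⟩ else Sum.inl ⟨e.1, h⟩
    have hf : Function.Injective f := by
      intro e e' h
      apply Subtype.ext
      simp only [f] at h
      split_ifs at h <;> simpa using h
    have := Nat.card_le_card_of_injective f hf
    rw [Nat.card_sum] at this
    omega
  have hGB : Nat.card G + Nat.card B = 4 ^ n := by
    have := Nat.card_congr (Equiv.sumCompl (fun e : ZMod n → Fin 4 => Has 0 e ∧ Has 3 e))
    rw [Nat.card_sum] at this
    rw [this, Nat.card_fun]
    simp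
  have hGR : Nat.card G ≤ Nat.card R := by
    have H : ∀ e : G, ∃ π : R, code π.1 = e.1 := by
      rintro ⟨e, ⟨b, hb0, hb1, hb2⟩, ⟨a, ha0, ha1, ha2⟩⟩
      obtain ⟨π, h1, h2⟩ := exists_real e a b ha0 ha1 ha2 hb0 hb1 hb2
      exact ⟨⟨π, h1⟩, h2⟩
    choose f hf using H
    apply Nat.card_le_card_of_injective f
    intro e e' h
    apply Subtype.ext
    rw [← hf, ← hf, h]
  have hRG : Nat.card R ≤ Nat.card G + 24 * Nat.card B := by
    let f : R → G ⊕ (Equiv.Perm (Fin 4) × B) := fun π =>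
      if h : Has 0 (code π.1) ∧ Has 3 (code π.1) then Sum.inl ⟨code π.1, h⟩
      else Sum.inr (π.1 0, ⟨code π.1, h⟩)
    have hf : Function.Injective f := by
      rintro ⟨π, c, hc⟩ ⟨π', c', hc'⟩ h
      apply Subtype.ext
      have w : Wit π c := hc
      have w' : Wit π' c' := hc'
      simp only [f] at h
      split_ifs at h with g1 g2 g2
      · have hcode : code π = code π' := by simpa [G] using h
        obtain ⟨b, h0, h1, h2⟩ := g1.1
        have s := state_of_const w b h0 h1 h2
        rw [hcode] at h0 h1 h2
        have s' := state_of_const w' b h0 h1 h2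
        exact eq_of_state w w' hcode (b+3) ⟨iff_of_true s.1 s'.1, iff_of_true s.2.1 s'.2.1,
          iff_of_true s.2.2 s'.2.2⟩
      · have h2 := Sum.inr_injective h
        have hcode : code π = code π' := congrArg Subtype.val (congrArg Prod.snd h2)
        exact eq_of_state w w' hcode 0 (state_of_perm w w' 0 (congrArg Prod.fst h2))
    have := Nat.card_le_card_of_injective f hf
    rw [Nat.card_sum, Nat.card_prod] at this
    simpa [Fintype.card_perm, Nat.factorial] using this
  have hM : M₄ n = Nat.card R := rfl
  rw [hM]
  omega

theorem m4_ratio_tendsto_one :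
    Filter.Tendsto (fun n : ℕ => (M₄ n : ℝ) / 4 ^ n) Filter.atTop (nhds 1) := by
  have h0 : Filter.Tendsto (fun n : ℕ => ((63:ℝ)/64) ^ (n/3)) Filter.atTop (nhds 0) :=
    (tendsto_pow_atTop_nhds_zero_of_lt_one (by norm_num) (by norm_num)).comp
      (Nat.tendsto_div_const_atTop (by norm_num))
  have hl : Filter.Tendsto (fun n : ℕ => 1 - 2 * ((63:ℝ)/64) ^ (n/3)) Filter.atTop (nhds 1) := by
    simpa using (h0.const_mul 2).const_sub 1
  have hu : Filter.Tendsto (fun n : ℕ => 1 + 48 * ((63:ℝ)/64) ^ (n/3)) Filter.atTop (nhds 1) := by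
    simpa using (h0.const_mul 48).const_add 1
  have key : ∀ n : ℕ, (4:ℝ) ^ n * ((63:ℝ)/64) ^ (n/3) = 63 ^ (n/3) * 4 ^ (n%3) := by
    intro n
    have : (4:ℝ) ^ n = 64 ^ (n/3) * 4 ^ (n%3) := by
      conv_lhs => rw [← Nat.div_add_mod n 3, pow_add, pow_mul]
      norm_num
    rw [this, div_pow]
    field_simp
  refine tendsto_of_tendsto_of_tendsto_of_le_of_le' hl hu ?_ ?_
  · filter_upwards [Filter.eventually_gt_atTop 0] with n hn
    have : NeZero n := ⟨hn.ne'⟩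
    have := (bounds n).1
    have h : (4:ℝ) ^ n ≤ M₄ n + 2 * (63 ^ (n/3) * 4 ^ (n%3)) := by exact_mod_cast this
    rw [le_div_iff₀ (by positivity)]
    rw [← key] at h
    linarith
  · filter_upwards [Filter.eventually_gt_atTop 0] with n hn
    have : NeZero n := ⟨hn.ne'⟩
    have := (bounds n).2
    have h : (M₄ n : ℝ) ≤ 4 ^ n + 24 * (2 * (63 ^ (n/3) * 4 ^ (n%3))) := by exact_mod_cast this
    rw [div_le_iff₀ (by positivity)]
    rw [← key] at h
    linarith
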